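/- arXiv:2507.07337 — 11 statements merged into one kernel-verified Lean document; each statement's English description precedes it below -/
import Mathlib

section
/- Let p be a prime, n a positive integer, and K = 𝔽_{p^n}. For every function F : K → K, every α ∈ K, and every x ∈ K, the (p−1)-st order discrete derivative of F with all p−1 directions equal to α satisfies Δ_{α,α,…,α} F(x) = −Δ_{α,2α,…,(p−1)α} F(x), where on the right-hand side the d = p−1 directions are i·α for i = 1, 2, …, p−1 (with i·α meaning the natural number i acting on α, i.e. α added i times). -/
/-- Discrete derivative of `F` in direction `α`: `Δ_α F x = F (x + α) - F x`. -/
def delta {A B : Type*} [Add A] [Sub B] (α : A) (F : A → B) : A → B :=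
  fun x => F (x + α) - F x

/-- Higher-order discrete derivative along a list of directions:
`Δ_{α₁,…,α_d} F = Δ_{α₁} (Δ_{α₂,…,α_d} F)`. -/
def deltaList {A B : Type*} [Add A] [Sub B] (l : List A) (F : A → B) : A → B :=
  l.foldr delta F

open Polynomial

/-- Modulo `(t - 1) ^ (m + 1)`, the product of the `t ^ i - 1` for `1 ≤ i ≤ m` is
`m! * (t - 1) ^ m`. -/
lemma exists_prod_pow_sub_one_eq {R : Type*} [CommRing R] (t : R) (m : ℕ) :
    ∃ r, ((List.range m).map (fun i => t ^ (i + 1) - 1)).prod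
      = m.factorial * (t - 1) ^ m + (t - 1) ^ (m + 1) * r := by
  induction m with
  | zero => exact ⟨0, by simp⟩
  | succ m ih =>
    obtain ⟨r, hr⟩ := ih
    have hgeom : t - 1 ∣ (∑ i ∈ Finset.range (m + 1), t ^ i) - (m + 1 : ℕ) := by
      have : (∑ i ∈ Finset.range (m + 1), t ^ i) - (m + 1 : ℕ)
          = ∑ i ∈ Finset.range (m + 1), (t ^ i - 1) := by simp
      rw [this]
      exact Finset.dvd_sum fun i _ => sub_one_dvd_pow_sub_one t i
    obtain ⟨c, hc⟩ := hgeom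
    refine ⟨m.factorial * c + r * ((m + 1 : ℕ) + (t - 1) * c), ?_⟩
    rw [List.range_succ, List.map_append, List.prod_append, hr, List.map_singleton,
      List.prod_singleton, ← geom_sum_mul, sub_eq_iff_eq_add.mp hc, Nat.factorial_succ]
    push_cast
    ring

section Translation

variable {K : Type*} [Field K]

/-- Translation of functions by `α`, as a linear endomorphism. -/
def translation (α : K) : Module.End K (K → K) :=
  LinearMap.funLeft K K (· + α)

lemma translation_pow_apply (α : K) (k : ℕ) (F : K → K) (x : K) :
    (translation α ^ k) F x = F (x + k • α) := by
  induction k generalizing x with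
  | zero => simp
  | succ k ih =>
    rw [pow_succ', Module.End.mul_apply]
    change (translation α ^ k) F (x + α) = _
    rw [ih, succ_nsmul', add_assoc]

lemma delta_nsmul (α : K) (k : ℕ) (F : K → K) :
    delta (k • α) F = (translation α ^ k - 1) F := by
  ext x
  simp [delta, translation_pow_apply]

lemma delta_iterate (α : K) (k : ℕ) (F : K → K) :
    (delta α)^[k] F = ((translation α - 1) ^ k) F := by
  have h : delta α = ⇑(translation α - 1) := by
    ext G x
    simpa using congrFun (delta_nsmul α 1 G) x
  rw [h, Module.End.pow_apply]

lemma deltaList_map_nsmul (α : K) (l : List ℕ) (F : K → K) :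
    deltaList (l.map (fun i => (i + 1) • α)) F
      = (l.map (fun i => translation α ^ (i + 1) - 1) : List (Module.End K (K → K))).prod F := by
  induction l with
  | nil => rfl
  | cons i l ih =>
    rw [List.map_cons, List.map_cons, List.prod_cons, Module.End.mul_apply, ← ih, ← delta_nsmul]
    rfl

lemma translation_sub_one_pow_char (p : ℕ) [Fact p.Prime] [CharP K p] (α : K) :
    (translation α - 1) ^ p = 0 := by
  have h : (X - 1 : K[X]) ^ p = X ^ p - 1 := by rw [sub_pow_char, one_pow]
  have h' := congrArg (aeval (translation α)) h
  simp only [map_pow, map_sub, aeval_X, map_one] at h'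
  rw [h']
  ext F x
  simp [translation_pow_apply]

lemma prod_translation_pow_sub_one (p : ℕ) [Fact p.Prime] [CharP K p] (α : K) :
    ((List.range (p - 1)).map (fun i => translation α ^ (i + 1) - 1)).prod
      = -(translation α - 1) ^ (p - 1) := by
  obtain ⟨r, hr⟩ := exists_prod_pow_sub_one_eq (X : K[X]) (p - 1)
  have hfac : ((p - 1).factorial : K[X]) = -1 := by
    rw [← map_natCast (ZMod.castHom dvd_rfl K[X]), ZMod.wilsons_lemma, map_neg, map_one]
  rw [hfac, Nat.sub_add_cancel (Fact.out : p.Prime).one_le] at hr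
  have h := congrArg (aeval (translation α)) hr
  simpa [map_list_prod, Function.comp_def, translation_sub_one_pow_char] using h

end Translation

theorem stmt_0 (p : ℕ) [Fact p.Prime] (n : ℕ) (hn : 0 < n)
    (F : GaloisField p n → GaloisField p n) (α : GaloisField p n)
    (x : GaloisField p n) :
    (delta α)^[p - 1] F x
      = - deltaList ((List.range (p - 1)).map (fun i => (i + 1) • α)) F x := by
  rw [delta_iterate, deltaList_map_nsmul, prod_translation_pow_sub_one p α]
  simp
end

section
/- Let p be a prime and ℓ an integer with 1 ≤ ℓ ≤ p−1. Then for every u ∈ 𝔽_p, the number of subsets S of 𝔽_p with |S| = ℓ and Σ_{s∈S} s = u is the same, namely p · #S_ℓ(u) = C(p, ℓ) (binomial coefficient p choose ℓ); in particular #S_ℓ(u) = C(p,ℓ)/p is independent of u. -/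
/-- `Scard p ℓ u` is the number of subsets `S ⊆ 𝔽_p` with `|S| = ℓ` and `∑_{s∈S} s = u`. -/
def Scard (p : ℕ) [NeZero p] (ℓ : ℕ) (u : ZMod p) : ℕ :=
  ((Finset.univ : Finset (Finset (ZMod p))).filter
    (fun S => S.card = ℓ ∧ ∑ s ∈ S, s = u)).card

/-- Translating by `c` maps `ℓ`-subsets of sum `u` injectively to `ℓ`-subsets of sum `u + ℓ c`. -/
lemma Scard_le_Scard_add_mul (p : ℕ) [NeZero p] (ℓ : ℕ) (u c : ZMod p) :
    Scard p ℓ u ≤ Scard p ℓ (u + ℓ * c) := by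
  refine Finset.card_le_card_of_injOn (Finset.map (addRightEmbedding c)) ?_
    (Finset.map_injective _).injOn
  intro S hS
  simp only [Finset.coe_filter, Finset.mem_univ, true_and, Set.mem_ofPred_eq] at hS ⊢
  obtain ⟨hcard, hsum⟩ := hS
  simp [hcard, hsum, Finset.sum_add_distrib]

/-- The `ℓ`-subsets of `ZMod p` are partitioned by their sums. -/
lemma sum_Scard (p : ℕ) [NeZero p] (ℓ : ℕ) : ∑ v : ZMod p, Scard p ℓ v = p.choose ℓ := by
  have h := Finset.card_eq_sum_card_fiberwise (f := fun S : Finset (ZMod p) => ∑ s ∈ S, s)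
    (s := Finset.powersetCard ℓ Finset.univ) (t := Finset.univ) (fun _ _ => by simp)
  rw [Finset.card_powersetCard, Finset.card_univ, ZMod.card] at h
  rw [h]
  refine Finset.sum_congr rfl fun v _ => congrArg Finset.card ?_
  ext S
  simp [Finset.mem_powersetCard]

theorem stmt_8 (p : ℕ) [Fact p.Prime] (ℓ : ℕ) (h1 : 1 ≤ ℓ) (h2 : ℓ ≤ p - 1)
    (u : ZMod p) :
    p * Scard p ℓ u = p.choose ℓ := by
  have hℓ : (ℓ : ZMod p) ≠ 0 := by
    rw [Ne, ZMod.natCast_eq_zero_iff]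
    exact Nat.not_dvd_of_pos_of_lt h1 (by omega)
  have hle (v w : ZMod p) : Scard p ℓ v ≤ Scard p ℓ w := by
    have h := Scard_le_Scard_add_mul p ℓ v ((w - v) / ℓ)
    rwa [mul_div_cancel₀ _ hℓ, add_sub_cancel] at h
  rw [← sum_Scard, Finset.sum_congr rfl fun v _ => (hle v u).antisymm (hle u v)]
  simp [ZMod.card]
end

section
/- Let p be a prime and ℓ an integer with 0 ≤ ℓ ≤ p−1. Then for all nonzero u, v ∈ 𝔽_p, the sets S*_ℓ(u) and S*_ℓ(v) have the same cardinality; that is, the number of subsets S of 𝔽_p \ {0} with |S| = ℓ and Σ_{s∈S} s = u does not depend on the choice of u ∈ 𝔽_p^*. -/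
/-- `SstarCard p ℓ u` is the number of subsets `S ⊆ 𝔽_p \ {0}` with `|S| = ℓ`
and `∑_{s∈S} s = u`. -/
def SstarCard (p : ℕ) [NeZero p] (ℓ : ℕ) (u : ZMod p) : ℕ :=
  ((Finset.univ : Finset (Finset (ZMod p))).filter
    (fun S => S.card = ℓ ∧ (0 : ZMod p) ∉ S ∧ ∑ s ∈ S, s = u)).card

/-- Multiplication by a nonzero `c` shows that the count for `u` is at most the count for `c * u`. -/
theorem SstarCard_le_mul (p : ℕ) [Fact p.Prime] (ℓ : ℕ) (c u : ZMod p) (hc : c ≠ 0) :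
    SstarCard p ℓ u ≤ SstarCard p ℓ (c * u) := by
  have hinj : Function.Injective (c * ·) := mul_right_injective₀ hc
  refine Finset.card_le_card_of_injOn (Finset.image (c * ·)) ?_
    (Finset.image_injective hinj).injOn
  intro S hS
  simp only [Finset.coe_filter, Finset.mem_univ, true_and, Set.mem_ofPred_eq] at hS ⊢
  obtain ⟨hcard, h0, hsum⟩ := hS
  refine ⟨by rw [Finset.card_image_of_injective _ hinj, hcard], ?_, ?_⟩
  · simpa [hc] using h0
  · rw [Finset.sum_image hinj.injOn, ← Finset.mul_sum, hsum]

theorem stmt_9 (p : ℕ) [Fact p.Prime] (ℓ : ℕ) (h2 : ℓ ≤ p - 1)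
    (u v : ZMod p) (hu : u ≠ 0) (hv : v ≠ 0) :
    SstarCard p ℓ u = SstarCard p ℓ v := by
  apply le_antisymm
  · simpa [hu] using SstarCard_le_mul p ℓ (v / u) u (div_ne_zero hv hu)
  · simpa [hv] using SstarCard_le_mul p ℓ (u / v) v (div_ne_zero hu hv)
end

section
/- Let p be a prime and ℓ an integer with 0 ≤ ℓ ≤ p−1. Then, as integers, #S*_ℓ(0) − #S*_ℓ(1) = (−1)^ℓ; that is, the number of ℓ-element subsets of 𝔽_p \ {0} summing to 0 minus the number of ℓ-element subsets of 𝔽_p \ {0} summing to 1 equals (−1)^ℓ. -/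
/-- Splitting the `(ℓ + 1)`-subsets of `𝔽_p` with sum `u` by whether they contain `0`. -/
lemma card_filter_card_sum_eq_SstarCard_add (p : ℕ) [NeZero p] (ℓ : ℕ) (u : ZMod p) :
    ((Finset.univ : Finset (Finset (ZMod p))).filter
      (fun S => S.card = ℓ + 1 ∧ ∑ s ∈ S, s = u)).card =
      SstarCard p (ℓ + 1) u + SstarCard p ℓ u := by
  rw [← Finset.card_filter_add_card_filter_not (fun S : Finset (ZMod p) => (0 : ZMod p) ∉ S)]
  congr 1
  · rw [Finset.filter_filter, SstarCard]
    congr 1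
    ext S
    simp only [Finset.mem_filter, Finset.mem_univ, true_and]
    tauto
  · rw [SstarCard]
    refine Finset.card_bij' (fun S _ => S.erase 0) (fun S _ => insert 0 S) ?_ ?_ ?_ ?_
    · intro S hS
      simp only [Finset.mem_filter, Finset.mem_univ, true_and, not_not] at hS ⊢
      obtain ⟨⟨hc, hs⟩, h0⟩ := hS
      refine ⟨by rw [Finset.card_erase_of_mem h0, hc, Nat.add_sub_cancel],
        Finset.notMem_erase _ _, ?_⟩
      rw [Finset.sum_erase S (f := fun s => s) rfl, hs]
    · intro S hS
      simp only [Finset.mem_filter, Finset.mem_univ, true_and, not_not] at hS ⊢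
      obtain ⟨hc, h0, hs⟩ := hS
      refine ⟨⟨by rw [Finset.card_insert_of_notMem h0, hc], ?_⟩, Finset.mem_insert_self _ _⟩
      rw [Finset.sum_insert h0, hs, zero_add]
    · intro S hS
      simp only [Finset.mem_filter, Finset.mem_univ, true_and, not_not] at hS
      exact Finset.insert_erase hS.2
    · intro S hS
      simp only [Finset.mem_filter, Finset.mem_univ, true_and] at hS
      exact Finset.erase_insert hS.2.1

/-- Translating by `c` shifts the sum of an `n`-subset by `n * c`. -/
lemma card_filter_card_sum_translate (p : ℕ) [NeZero p] (n : ℕ) (u c : ZMod p) :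
    ((Finset.univ : Finset (Finset (ZMod p))).filter
      (fun S => S.card = n ∧ ∑ s ∈ S, s = u)).card =
    ((Finset.univ : Finset (Finset (ZMod p))).filter
      (fun S => S.card = n ∧ ∑ s ∈ S, s = u + n * c)).card := by
  refine Finset.card_equiv (Equiv.addRight c).finsetCongr fun S => ?_
  simp only [Finset.mem_filter, Finset.mem_univ, true_and, Equiv.finsetCongr_apply,
    Finset.card_map, Finset.sum_map, Equiv.coe_toEmbedding, Equiv.coe_addRight,
    Finset.sum_add_distrib, Finset.sum_const, nsmul_eq_mul]
  refine and_congr_right fun h => ?_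
  rw [h, add_left_inj]

theorem stmt_11 (p : ℕ) [Fact p.Prime] (ℓ : ℕ) (h2 : ℓ ≤ p - 1) :
    (SstarCard p ℓ 0 : ℤ) - SstarCard p ℓ 1 = (-1) ^ ℓ := by
  induction ℓ with
  | zero =>
    have h0 : SstarCard p 0 0 = 1 := by
      rw [SstarCard, Finset.card_eq_one]
      refine ⟨∅, ?_⟩
      ext S
      simp only [Finset.mem_filter, Finset.mem_univ, true_and, Finset.card_eq_zero,
        Finset.mem_singleton]
      exact ⟨fun h => h.1, by rintro rfl; simp⟩
    have h1 : SstarCard p 0 1 = 0 := by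
      rw [SstarCard, Finset.card_eq_zero, Finset.filter_eq_empty_iff]
      rintro S - ⟨hc, -, hs⟩
      rw [Finset.card_eq_zero.mp hc, Finset.sum_empty] at hs
      exact zero_ne_one hs
    simp [h0, h1]
  | succ ℓ ih =>
    have ih := ih (by omega)
    have hne : ((ℓ + 1 : ℕ) : ZMod p) ≠ 0 := by
      rw [Ne, ZMod.natCast_eq_zero_iff]
      intro h
      have := Nat.le_of_dvd (Nat.succ_pos ℓ) h
      have := (Fact.out : p.Prime).pos
      omega
    have key := card_filter_card_sum_translate p (ℓ + 1) 0 ((ℓ + 1 : ℕ) : ZMod p)⁻¹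
    rw [mul_inv_cancel₀ hne, zero_add, card_filter_card_sum_eq_SstarCard_add,
      card_filter_card_sum_eq_SstarCard_add] at key
    rw [pow_succ, ← ih]
    lia
end

section
/- Let p be a prime and ℓ an integer with 1 ≤ ℓ ≤ p−1. Then, as integers, p · #S*_ℓ(1) = Σ_{i=0}^{ℓ−1} (−1)^i C(p, ℓ−i), where C(a,b) is the binomial coefficient; that is, the number of ℓ-element subsets of 𝔽_p \ {0} summing to 1 equals (1/p) Σ_{i=0}^{ℓ−1} (−1)^i C(p, ℓ−i). -/
/-- Every fibre of the sum map on the `ℓ`-subsets of `𝔽_p` has the same size when `0 < ℓ < p`. -/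
lemma card_filter_card_eq_sum_eq_const {p : ℕ} [Fact p.Prime] {ℓ : ℕ} (h1 : 0 < ℓ) (h2 : ℓ < p)
    (u v : ZMod p) :
    ((Finset.univ : Finset (Finset (ZMod p))).filter
      (fun S => S.card = ℓ ∧ ∑ s ∈ S, s = u)).card =
    ((Finset.univ : Finset (Finset (ZMod p))).filter
      (fun S => S.card = ℓ ∧ ∑ s ∈ S, s = v)).card := by
  have hℓ : (ℓ : ZMod p) ≠ 0 := by
    rw [Ne, ZMod.natCast_eq_zero_iff]
    exact Nat.not_dvd_of_pos_of_lt h1 h2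
  refine Finset.card_equiv (Equiv.addRight ((v - u) / (ℓ : ZMod p))).finsetCongr fun S => ?_
  simp only [Finset.mem_filter, Finset.mem_univ, true_and, Equiv.finsetCongr_apply,
    Finset.card_map, Finset.sum_map, Equiv.coe_toEmbedding, Equiv.coe_addRight,
    Finset.sum_add_distrib, Finset.sum_const, nsmul_eq_mul]
  refine and_congr_right fun hS => ?_
  rw [hS, mul_div_cancel₀ _ hℓ, ← eq_sub_iff_add_eq, sub_sub_cancel]

lemma mul_card_filter_card_eq_sum_eq {p : ℕ} [Fact p.Prime] {ℓ : ℕ} (h1 : 0 < ℓ) (h2 : ℓ < p)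
    (u : ZMod p) :
    p * ((Finset.univ : Finset (Finset (ZMod p))).filter
      (fun S => S.card = ℓ ∧ ∑ s ∈ S, s = u)).card = p.choose ℓ := by
  have h := Finset.card_eq_sum_card_fiberwise (f := fun S : Finset (ZMod p) => ∑ s ∈ S, s)
    (s := Finset.univ.filter fun S : Finset (ZMod p) => S.card = ℓ) (t := Finset.univ)
    (fun _ _ => by simp)
  simp only [Finset.filter_filter] at h
  rw [Finset.sum_congr rfl fun v _ => card_filter_card_eq_sum_eq_const h1 h2 v u,
    Finset.sum_const, Finset.card_univ, ZMod.card, smul_eq_mul] at h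
  rw [← h, ← Finset.powerset_univ, ← Finset.powersetCard_eq_filter, Finset.card_powersetCard,
    Finset.card_univ, ZMod.card]

/-- Splitting the `(ℓ + 1)`-subsets with sum `u` by whether they contain `0`. -/
lemma card_filter_card_eq_sum_eq_succ {p : ℕ} [NeZero p] (ℓ : ℕ) (u : ZMod p) :
    ((Finset.univ : Finset (Finset (ZMod p))).filter
      (fun S => S.card = ℓ + 1 ∧ ∑ s ∈ S, s = u)).card =
    SstarCard p (ℓ + 1) u + SstarCard p ℓ u := by
  rw [← Finset.card_filter_add_card_filter_not (fun S : Finset (ZMod p) => (0 : ZMod p) ∉ S)]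
  simp only [Finset.filter_filter, not_not, SstarCard]
  congr 1
  · congr 1
    ext S
    simp only [Finset.mem_filter]
    tauto
  · refine Finset.card_bij' (fun S _ => S.erase 0) (fun S _ => insert 0 S) ?_ ?_ ?_ ?_
    · simp only [Finset.mem_filter, Finset.mem_univ, true_and]
      rintro S ⟨⟨hc, hs⟩, h0⟩
      refine ⟨by rw [Finset.card_erase_of_mem h0, hc, Nat.add_sub_cancel],
        Finset.notMem_erase 0 S, ?_⟩
      rw [Finset.sum_erase S rfl, hs]
    · simp only [Finset.mem_filter, Finset.mem_univ, true_and]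
      rintro S ⟨hc, h0, hs⟩
      simp [Finset.card_insert_of_notMem h0, Finset.sum_insert h0, hc, hs]
    · intro S hS
      exact Finset.insert_erase (Finset.mem_filter.mp hS).2.2
    · intro S hS
      exact Finset.erase_insert (Finset.mem_filter.mp hS).2.2.1

lemma SstarCard_zero_of_ne_zero {p : ℕ} [NeZero p] {u : ZMod p} (hu : u ≠ 0) :
    SstarCard p 0 u = 0 := by
  rw [SstarCard, Finset.card_eq_zero, Finset.filter_eq_empty_iff]
  rintro S - ⟨hc, -, hs⟩
  rw [Finset.card_eq_zero.mp hc, Finset.sum_empty] at hs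
  exact hu hs.symm

lemma mul_SstarCard_of_ne_zero {p : ℕ} [Fact p.Prime] {u : ZMod p} (hu : u ≠ 0) {ℓ : ℕ}
    (h : ℓ < p) :
    (p : ℤ) * SstarCard p ℓ u
      = ∑ i ∈ Finset.range ℓ, (-1 : ℤ) ^ i * (p.choose (ℓ - i) : ℤ) := by
  induction ℓ with
  | zero => simp [SstarCard_zero_of_ne_zero hu]
  | succ ℓ ih =>
    have key := mul_card_filter_card_eq_sum_eq ℓ.succ_pos h u
    rw [card_filter_card_eq_sum_eq_succ] at key
    have key' : (p : ℤ) * (SstarCard p (ℓ + 1) u + SstarCard p ℓ u) = p.choose (ℓ + 1) := by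
      exact_mod_cast key
    rw [mul_add, ih (Nat.lt_of_succ_lt h)] at key'
    rw [Finset.sum_range_succ']
    simp only [pow_succ, Nat.add_sub_add_right, mul_neg, mul_one, neg_mul,
      Finset.sum_neg_distrib, pow_zero, one_mul, Nat.sub_zero]
    linarith

theorem stmt_12 (p : ℕ) [Fact p.Prime] (ℓ : ℕ) (h1 : 1 ≤ ℓ) (h2 : ℓ ≤ p - 1) :
    (p : ℤ) * SstarCard p ℓ 1
      = ∑ i ∈ Finset.range ℓ, (-1 : ℤ) ^ i * (p.choose (ℓ - i) : ℤ) :=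
  mul_SstarCard_of_ne_zero one_ne_zero (by omega)
end

section
/- Let p be a prime and ℓ an integer with 0 ≤ ℓ ≤ p−1. Then C(p−1, ℓ) = #S*_ℓ(0) + (p−1) · #S*_ℓ(1), where C(p−1,ℓ) is the binomial coefficient; i.e. the total number of ℓ-element subsets of 𝔽_p \ {0} equals the number summing to 0 plus (p−1) times the number summing to 1. -/
theorem SstarCard_mul (p : ℕ) [Fact p.Prime] (ℓ : ℕ) {c : ZMod p} (hc : c ≠ 0) (u : ZMod p) :
    SstarCard p ℓ (c * u) = SstarCard p ℓ u := by
  symm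
  refine Finset.card_equiv (Equiv.mulLeft₀ c hc).finsetCongr fun S => ?_
  have hsum : ∑ s ∈ S, c * s = c * u ↔ ∑ s ∈ S, s = u := by
    rw [← Finset.mul_sum, mul_right_inj' hc]
  simp [Finset.sum_map, hsum]

theorem sum_SstarCard (p : ℕ) [Fact p.Prime] (ℓ : ℕ) :
    ∑ u, SstarCard p ℓ u = (p - 1).choose ℓ := by
  have hcard : (Finset.univ.erase (0 : ZMod p)).card = p - 1 := by
    rw [Finset.card_erase_of_mem (Finset.mem_univ _), Finset.card_univ, ZMod.card]
  rw [← hcard, ← Finset.card_powersetCard,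
    Finset.card_eq_sum_card_fiberwise (f := fun S => ∑ s ∈ S, s) (t := Finset.univ)
      fun _ _ => Finset.mem_univ _]
  refine Finset.sum_congr rfl fun u _ => congrArg Finset.card ?_
  ext S
  simp only [Finset.mem_filter, Finset.mem_univ, true_and, Finset.mem_powersetCard,
    Finset.subset_erase, Finset.subset_univ]
  tauto

theorem stmt_13 (p : ℕ) [Fact p.Prime] (ℓ : ℕ) (h2 : ℓ ≤ p - 1) :
    (p - 1).choose ℓ = SstarCard p ℓ 0 + (p - 1) * SstarCard p ℓ 1 := by
  rw [← sum_SstarCard, ← Finset.add_sum_erase _ _ (Finset.mem_univ (0 : ZMod p)),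
    Finset.sum_const_nat (m := SstarCard p ℓ 1), Finset.card_erase_of_mem (Finset.mem_univ _),
    Finset.card_univ, ZMod.card]
  intro u hu
  simpa using SstarCard_mul p ℓ (Finset.ne_of_mem_erase hu) 1
end

section
/- Let p be an odd prime. Writing S*_ℓ := #S*_ℓ(1) for the number of ℓ-element subsets of 𝔽_p \ {0} whose elements sum to 1, the alternating sum satisfies Σ_{i=1}^{(p−1)/2} (S*_{2i} − S*_{2i−1}) ≡ −1 (mod p), where the subtraction is taken in ℤ and the congruence is modulo p. -/
theorem Finset.sum_Icc_even_sub_odd (f : ℕ → ℤ) (n : ℕ) :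
    ∑ i ∈ Finset.Icc 1 n, (f (2 * i) - f (2 * i - 1)) =
      (∑ j ∈ Finset.range (2 * n + 1), (-1) ^ j * f j) - f 0 := by
  induction n with
  | zero => simp
  | succ n ih =>
    rw [Finset.sum_Icc_succ_top (by omega), ih, show 2 * (n + 1) + 1 = 2 * n + 1 + 1 + 1 by ring,
      Finset.sum_range_succ _ (2 * n + 1 + 1), Finset.sum_range_succ _ (2 * n + 1),
      show 2 * (n + 1) - 1 = 2 * n + 1 by omega, show 2 * (n + 1) = 2 * n + 1 + 1 by ring]
    have h : (-1 : ℤ) ^ (2 * n + 1) = -1 := Odd.neg_one_pow ⟨n, rfl⟩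
    rw [pow_succ (-1 : ℤ) (2 * n + 1), h]
    ring

/-- The signed count of the subsets of `𝔽_p \ {0}` with sum `u`. -/
theorem sum_neg_one_pow_mul_SstarCard (p : ℕ) [NeZero p] (u : ZMod p) :
    ∑ j ∈ Finset.range p, (-1 : ℤ) ^ j * (SstarCard p j u : ℤ) =
      ∑ S ∈ (Finset.univ.erase (0 : ZMod p)).powerset,
        if ∑ s ∈ S, s = u then (-1 : ℤ) ^ S.card else 0 := by
  rw [← Finset.sum_fiberwise_of_maps_to (t := Finset.range p) (g := Finset.card)]
  · refine Finset.sum_congr rfl fun j _ => ?_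
    rw [← Finset.sum_filter, SstarCard, Finset.filter_filter,
      Finset.sum_congr rfl (g := fun _ => (-1 : ℤ) ^ j)
        (fun S hS => by rw [(Finset.mem_filter.1 hS).2.1]),
      Finset.sum_const, nsmul_eq_mul, mul_comm]
    congr 3
    ext S
    simp only [Finset.mem_filter, Finset.mem_univ, true_and, Finset.mem_powerset,
      Finset.subset_erase, Finset.subset_univ]
    tauto
  · intro S hS
    have h := Finset.card_le_card (Finset.mem_powerset.1 hS)
    rw [Finset.card_erase_of_mem (Finset.mem_univ _), Finset.card_univ, ZMod.card] at h
    have := NeZero.pos p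
    exact Finset.mem_range.2 (by omega)

theorem ZMod.prod_erase_zero_one_sub_stdAddChar (p : ℕ) [Fact p.Prime] :
    ∏ a ∈ Finset.univ.erase (0 : ZMod p), (1 - ZMod.stdAddChar a : ℂ) = p := by
  obtain ⟨n, rfl⟩ : ∃ n, p = n + 1 := ⟨p - 1, by have := (Fact.out : p.Prime).pos; omega⟩
  have hζ : IsPrimitiveRoot (ZMod.stdAddChar (1 : ZMod (n + 1))) (n + 1) := by
    have h := Complex.isPrimitiveRoot_exp (n + 1) (by omega)
    convert h using 1
    have := ZMod.stdAddChar_coe (N := n + 1) 1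
    simpa using this
  have key := hζ.prod_one_sub_pow_eq_order
  push_cast
  rw [← key]
  symm
  refine Finset.prod_bij (fun k _ => ((k + 1 : ℕ) : ZMod (n + 1))) ?_ ?_ ?_ ?_
  · intro k hk
    have hk := Finset.mem_range.1 hk
    refine Finset.mem_erase.2 ⟨fun h => ?_, Finset.mem_univ _⟩
    have := Nat.le_of_dvd (by omega) ((ZMod.natCast_eq_zero_iff _ _).1 h)
    omega
  · intro a ha b hb h
    have ha := Finset.mem_range.1 ha
    have hb := Finset.mem_range.1 hb
    rw [ZMod.natCast_eq_natCast_iff', Nat.mod_eq_of_lt (by omega),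
      Nat.mod_eq_of_lt (by omega)] at h
    omega
  · intro b hb
    have h0 : b.val ≠ 0 := fun h => Finset.ne_of_mem_erase hb ((ZMod.val_eq_zero b).1 h)
    have hlt := ZMod.val_lt b
    refine ⟨b.val - 1, Finset.mem_range.2 (by omega), ?_⟩
    rw [Nat.sub_add_cancel (by omega), ZMod.natCast_zmod_val]
  · intro k _
    rw [← AddChar.map_nsmul_eq_pow, nsmul_one]

theorem ZMod.prod_erase_zero_one_sub_stdAddChar_mul (p : ℕ) [Fact p.Prime] (k : ZMod p) :
    ∏ a ∈ Finset.univ.erase (0 : ZMod p), (1 - ZMod.stdAddChar (k * a) : ℂ) =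
      if k = 0 then 0 else (p : ℂ) := by
  split_ifs with hk
  · exact Finset.prod_eq_zero (Finset.mem_erase.2 ⟨one_ne_zero, Finset.mem_univ _⟩) (by simp [hk])
  · rw [← ZMod.prod_erase_zero_one_sub_stdAddChar p]
    refine Finset.prod_bij (fun a _ => k * a) ?_ ?_ ?_ ?_
    · simp [hk]
    · intro a _ b _ h
      exact mul_left_cancel₀ hk h
    · intro b hb
      exact ⟨k⁻¹ * b, by simpa [hk] using hb, mul_inv_cancel_left₀ hk b⟩
    · simp

theorem AddChar.map_mul_sum {R M ι : Type*} [CommRing R] [CommMonoid M] (ψ : AddChar R M)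
    (k : R) (f : ι → R) (S : Finset ι) : ψ (k * ∑ s ∈ S, f s) = ∏ s ∈ S, ψ (k * f s) := by
  rw [Finset.mul_sum]
  exact map_prod ψ.toMonoidHom (fun s => Multiplicative.ofAdd (k * f s)) S

theorem sum_powerset_neg_one_pow_card_of_sum_eq (p : ℕ) [Fact p.Prime] {u : ZMod p} (hu : u ≠ 0) :
    (∑ S ∈ (Finset.univ.erase (0 : ZMod p)).powerset,
        if ∑ s ∈ S, s = u then (-1 : ℤ) ^ S.card else 0) = -1 := by
  have hp : (p : ℂ) ≠ 0 := Nat.cast_ne_zero.2 (Fact.out : p.Prime).ne_zero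
  have orth (b : ZMod p) : ∑ k : ZMod p, (ZMod.stdAddChar (k * b) : ℂ) =
      if b = 0 then (p : ℂ) else 0 := by
    simpa using AddChar.sum_mulShift b (ZMod.isPrimitive_stdAddChar p)
  have expand (k : ZMod p) :
      ∏ a ∈ Finset.univ.erase (0 : ZMod p), (1 - ZMod.stdAddChar (k * a) : ℂ) =
      ∑ S ∈ (Finset.univ.erase (0 : ZMod p)).powerset,
        (-1) ^ S.card * ZMod.stdAddChar (k * ∑ s ∈ S, s) := by
    simp_rw [sub_eq_add_neg, Finset.prod_one_add, Finset.prod_neg, AddChar.map_mul_sum]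
  have lhs : ∑ k : ZMod p, (ZMod.stdAddChar (k * -u) : ℂ) *
      ∏ a ∈ Finset.univ.erase (0 : ZMod p), (1 - ZMod.stdAddChar (k * a) : ℂ) = -p := by
    have h := orth (-u)
    rw [if_neg (neg_ne_zero.2 hu), ← Finset.add_sum_erase _ _ (Finset.mem_univ 0)] at h
    rw [← Finset.add_sum_erase _ _ (Finset.mem_univ 0),
      ZMod.prod_erase_zero_one_sub_stdAddChar_mul, if_pos rfl, mul_zero, zero_add,
      Finset.sum_congr rfl fun k hk => by
        rw [ZMod.prod_erase_zero_one_sub_stdAddChar_mul, if_neg (Finset.ne_of_mem_erase hk)],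
      ← Finset.sum_mul]
    rw [zero_mul, AddChar.map_zero_eq_one] at h
    linear_combination (p : ℂ) * h
  rw [Finset.sum_congr rfl fun k _ => by rw [expand, Finset.mul_sum], Finset.sum_comm] at lhs
  have inner (S : Finset (ZMod p)) : ∑ k : ZMod p, (ZMod.stdAddChar (k * -u) : ℂ) *
      ((-1) ^ S.card * ZMod.stdAddChar (k * ∑ s ∈ S, s)) =
      p * if ∑ s ∈ S, s = u then (-1) ^ S.card else 0 := by
    have h := orth (∑ s ∈ S, s - u)
    simp only [sub_eq_zero] at h
    calc _ = (-1) ^ S.card * ∑ k : ZMod p, (ZMod.stdAddChar (k * (∑ s ∈ S, s - u)) : ℂ) := by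
          rw [Finset.mul_sum]
          refine Finset.sum_congr rfl fun k _ => ?_
          rw [mul_left_comm, ← AddChar.map_add_eq_mul]
          ring_nf
      _ = _ := by
          rw [h]
          split_ifs <;> ring
  rw [Finset.sum_congr rfl fun S _ => inner S, ← Finset.mul_sum] at lhs
  have := mul_left_cancel₀ hp (lhs.trans (mul_neg_one (p : ℂ)).symm)
  exact_mod_cast this

theorem stmt_14 (p : ℕ) [Fact p.Prime] (hodd : p ≠ 2) :
    (∑ i ∈ Finset.Icc 1 ((p - 1) / 2),
        ((SstarCard p (2 * i) 1 : ℤ) - (SstarCard p (2 * i - 1) 1 : ℤ)))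
      ≡ -1 [ZMOD (p : ℤ)] := by
  have hp : 2 * ((p - 1) / 2) + 1 = p := by
    obtain ⟨m, hm⟩ := (Fact.out : p.Prime).odd_of_ne_two hodd
    omega
  have h0 : SstarCard p 0 1 = 0 := by
    rw [SstarCard, Finset.card_eq_zero, Finset.filter_eq_empty_iff]
    rintro S - ⟨hS, -, hsum⟩
    simp [Finset.card_eq_zero.1 hS] at hsum
  rw [Finset.sum_Icc_even_sub_odd (fun j => (SstarCard p j 1 : ℤ)), hp, h0,
    sum_neg_one_pow_mul_SstarCard, sum_powerset_neg_one_pow_card_of_sum_eq p one_ne_zero]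
  rfl
end

section
/- Let p be a prime, n a positive integer, K = 𝔽_{p^n}, F : K → K a function, and α ∈ K a nonzero element. There exists a function G : K → K such that F(x) = Δ_{α,…,α} G(x) for all x (the (p−1)-fold iterated derivative of G in direction α) if and only if Δ_α F(x) = 0 for all x ∈ K. -/
/-- `delta` agrees with Mathlib's forward difference operator. -/
theorem delta_eq_fwdDiff {A B : Type*} [AddCommMonoid A] [AddCommGroup B] (α : A) :
    (delta α : (A → B) → A → B) = fwdDiff α := rfl

/-- In characteristic `p`, the `p`-fold derivative in any fixed direction vanishes. -/
theorem delta_iterate_char_eq_zero {A B : Type*} [AddCommMonoid A] [Ring B] (p : ℕ)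
    [hp : Fact p.Prime] [CharP B p] {α : A} (hα : p • α = 0) (G : A → B) (x : A) :
    (delta α)^[p] G x = 0 := by
  rw [delta_eq_fwdDiff, fwdDiff_iter_eq_sum_shift, Finset.sum_range_succ,
    ← Nat.sub_add_cancel hp.out.one_le, Finset.sum_range_succ', Nat.sub_add_cancel hp.out.one_le,
    Finset.sum_eq_zero]
  · simp [hα, zsmul_eq_mul, neg_one_pow_char B p]
  · intro k hk
    have hk' := Finset.mem_range.mp hk
    have : ((p.choose (k + 1) : ℕ) : B) = 0 :=
      (CharP.cast_eq_zero_iff B p _).mpr (hp.out.dvd_choose_self k.succ_ne_zero (by omega))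
    simp [zsmul_eq_mul, this]

/-- A factor that is periodic in direction `α` can be pulled out of iterated derivatives in
direction `α`, and an additive coordinate `L` reduces them to forward differences in `L α`. -/
theorem delta_iterate_comp_smul {A C R B : Type*} [AddCommMonoid A] [AddCommMonoid C] [Ring R]
    [AddCommGroup B] [Module R B] (L : A →+ C) (α : A) {F : A → B}
    (hF : ∀ x, F (x + α) = F x) (k : ℕ) (u : C → R) :
    (delta α)^[k] (fun x => u (L x) • F x) = fun x => (delta (L α))^[k] u (L x) • F x := by
  induction k generalizing u with
  | zero => rfl
  | succ k ih =>
    rw [Function.iterate_succ_apply, Function.iterate_succ_apply, ← ih]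
    congr 1
    ext x
    simp [delta, hF, sub_smul]

theorem stmt_15 (p : ℕ) [Fact p.Prime] (n : ℕ) (hn : 0 < n)
    (F : GaloisField p n → GaloisField p n) (α : GaloisField p n) (hα : α ≠ 0) :
    (∃ G : GaloisField p n → GaloisField p n,
        ∀ x, F x = (delta α)^[p - 1] G x)
      ↔ (∀ x, delta α F x = 0) := by
  have hp : p - 1 + 1 = p := Nat.sub_add_cancel (Fact.out : p.Prime).one_le
  constructor
  · rintro ⟨G, hG⟩ x
    rw [funext hG, ← Function.iterate_succ_apply' (delta α), Nat.succ_eq_add_one, hp]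
    exact delta_iterate_char_eq_zero p (by simp) G x
  · intro hF
    obtain ⟨L, hL⟩ := Module.Projective.exists_dual_eq_one (ZMod p) hα
    refine ⟨fun x => ((-1 : ZMod p) • fun y : ZMod p => y ^ (p - 1)) (L x) • F x, fun x => ?_⟩
    have h := congrFun (delta_iterate_comp_smul L.toAddMonoidHom α
      (fun x => sub_eq_zero.mp (hF x)) (p - 1)
      ((-1 : ZMod p) • fun y : ZMod p => y ^ (p - 1))) x
    simp only [LinearMap.toAddMonoidHom_coe, hL] at h
    rw [h, delta_eq_fwdDiff, fwdDiff_iter_const_smul, fwdDiff_iter_eq_factorial]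
    simp [ZMod.wilsons_lemma]
end

section
/- Let p be a prime, n a positive integer, and f : (Fin n → ZMod p) → ZMod p a function with algebraic normal form P, i.e. P : MvPolynomial (Fin n) (ZMod p) satisfies deg_{x_j}(P) ≤ p−1 for every variable index j and f(x) = eval x P for all x. Fix a variable index i and let e_i ∈ (Fin n → ZMod p) be the vector with 1 in coordinate i and 0 elsewhere. Then the (p−1)-fold iterated derivative of f in direction e_i is the zero function if and only if deg_{x_i}(P) < p−1, where deg_{x_i} denotes the degree of P in the variable x_i (MvPolynomial.degreeOf i). -/
/-- A factor invariant under translation by `e_i` passes through the iterated derivative. -/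
lemma delta_single_iterate_mul {ι R : Type*} [DecidableEq ι] [CommRing R] (i : ι)
    (h : (ι → R) → R) (hh : ∀ x, h (x + Pi.single i 1) = h x) (g : R → R) (k : ℕ) :
    (delta (Pi.single i (1 : R)))^[k] (fun x => h x * g (x i)) =
      fun x => h x * (fwdDiff 1)^[k] g (x i) := by
  induction k with
  | zero => rfl
  | succ k ih =>
    rw [Function.iterate_succ_apply', ih, Function.iterate_succ_apply']
    funext x
    simp [delta, fwdDiff, hh, mul_sub]

lemma delta_single_iterate_eval {ι R : Type*} [Fintype ι] [DecidableEq ι] [CommRing R]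
    (P : MvPolynomial ι R) (i : ι) (k : ℕ) (x : ι → R) :
    (delta (Pi.single i (1 : R)))^[k] (fun y => MvPolynomial.eval y P) x =
      ∑ m ∈ P.support, P.coeff m * (∏ j ∈ Finset.univ.erase i, x j ^ m j) *
        (fwdDiff 1)^[k] (fun t : R => t ^ m i) (x i) := by
  have key (m : ι →₀ ℕ) := delta_single_iterate_mul i
    (fun y : ι → R => P.coeff m * ∏ j ∈ Finset.univ.erase i, y j ^ m j)
    (fun y => by
      congr 1
      refine Finset.prod_congr rfl fun j hj => ?_
      simp [Finset.ne_of_mem_erase hj]) (fun t => t ^ m i) k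
  have hP : (fun y => MvPolynomial.eval y P) = ∑ m ∈ P.support, fun y : ι → R =>
      P.coeff m * (∏ j ∈ Finset.univ.erase i, y j ^ m j) * y i ^ m i := by
    funext y
    rw [MvPolynomial.eval_eq', Finset.sum_apply]
    refine Finset.sum_congr rfl fun m _ => ?_
    rw [mul_assoc, Finset.prod_erase_mul _ _ (Finset.mem_univ i)]
  have hd : delta (A := ι → R) (B := R) (Pi.single i 1) = fwdDiff (Pi.single i 1) := rfl
  rw [hP]
  simp only [hd] at key ⊢
  rw [fwdDiff_iter_finsetSum, Finset.sum_apply]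
  exact Finset.sum_congr rfl fun m _ => congrFun (key m) x

theorem stmt_17 (p : ℕ) [Fact p.Prime] (n : ℕ) (hn : 0 < n)
    (f : (Fin n → ZMod p) → ZMod p)
    (P : MvPolynomial (Fin n) (ZMod p))
    (hdeg : ∀ j : Fin n, P.degreeOf j ≤ p - 1)
    (hval : ∀ x : Fin n → ZMod p, f x = MvPolynomial.eval x P)
    (i : Fin n) :
    (∀ x : Fin n → ZMod p, (delta (Pi.single i (1 : ZMod p)))^[p - 1] f x = 0)
      ↔ P.degreeOf i < p - 1 := by
  have hp : p.Prime := Fact.out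
  have hle (m) (hm : m ∈ P.support) (j : Fin n) : m j ≤ p - 1 :=
    (MvPolynomial.monomial_le_degreeOf j hm).trans (hdeg j)
  rw [funext hval, MvPolynomial.degreeOf_lt_iff (Nat.sub_pos_of_lt hp.one_lt)]
  simp only [delta_single_iterate_eval]
  constructor
  · intro h m hm
    refine (hle m hm i).lt_of_ne fun hmi => ?_
    let R : MvPolynomial (Fin n) (ZMod p) :=
      ∑ m ∈ P.support with m i = p - 1, MvPolynomial.monomial m (P.coeff m)
    have hcoeff (m) : R.coeff m = if m i = p - 1 then P.coeff m else 0 := by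
      simp only [R, MvPolynomial.coeff_sum, MvPolynomial.coeff_monomial, Finset.sum_ite_eq',
        Finset.mem_filter, MvPolynomial.mem_support_iff]
      grind
    have hR : R = 0 := by
      refine MvPolynomial.eq_zero_of_eval_zero_at_prod_finset R (fun _ => Finset.univ)
        (fun j => ?_) fun x _ => ?_
      · rw [Finset.card_univ, ZMod.card,
          MvPolynomial.degreeOf_lt_iff hp.pos]
        intro m hm
        rw [MvPolynomial.mem_support_iff, hcoeff] at hm
        have := hle m (MvPolynomial.mem_support_iff.2 (by grind)) j
        have := hp.pos
        omega
      · have hfac : ((p - 1).factorial : ZMod p) ≠ 0 := by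
          rw [ZMod.wilsons_lemma]
          simp
        refine (mul_eq_zero.1 ?_).resolve_left hfac
        rw [← mul_zero (x i ^ (p - 1)), ← h x, map_sum, Finset.mul_sum, Finset.mul_sum,
          Finset.sum_filter]
        refine Finset.sum_congr rfl fun m hm => ?_
        split_ifs with hmi
        · rw [hmi, fwdDiff_iter_eq_factorial, MvPolynomial.eval_monomial,
            Finsupp.prod_fintype _ _ (by simp),
            ← Finset.prod_erase_mul _ _ (Finset.mem_univ i), hmi]
          simp only [Pi.natCast_apply]
          ring
        · rw [fwdDiff_iter_pow_eq_zero_of_lt ((hle m hm i).lt_of_ne hmi)]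
          simp
    have := hcoeff m
    rw [hR, if_pos hmi, MvPolynomial.coeff_zero] at this
    exact MvPolynomial.mem_support_iff.1 hm this.symm
  · intro h x
    refine Finset.sum_eq_zero fun m hm => ?_
    rw [fwdDiff_iter_pow_eq_zero_of_lt (h m hm)]
    simp
end

section
/- Let p be a prime, n ≥ 2, and f, g : (Fin n → ZMod p) → ZMod p functions. Let i ≠ j be two variable indices and suppose Δ_{e_i} f(x) = Δ_{e_j} g(x) for all x, where e_i, e_j are the standard basis vectors. Let R be the algebraic normal form of this common derivative h = Δ_{e_i} f = Δ_{e_j} g (the unique polynomial with degree at most p−1 in each variable evaluating to h). Then deg_{x_i}(R) < p−1 and deg_{x_j}(R) < p−1. -/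
theorem sum_delta_update_eq_zero {p n : ℕ} [NeZero p] (f : (Fin n → ZMod p) → ZMod p)
    (i : Fin n) (x : Fin n → ZMod p) :
    ∑ t : ZMod p, delta (Pi.single i (1 : ZMod p)) f (Function.update x i t) = 0 := by
  have key : ∀ t : ZMod p,
      Function.update x i t + Pi.single i (1 : ZMod p) = Function.update x i (t + 1) := by
    intro t
    ext k
    by_cases hk : k = i
    · subst hk; simp
    · simp [hk]
  simp only [delta, key, Finset.sum_sub_distrib]
  exact sub_eq_zero.2
    (Equiv.sum_comp (Equiv.addRight (1 : ZMod p)) fun t => f (Function.update x i t))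

theorem ZMod.sum_pow_card_sub_one (p : ℕ) [Fact p.Prime] :
    ∑ t : ZMod p, t ^ (p - 1) = -1 := by
  simp only [ZMod.pow_card_sub_one]
  rw [Finset.sum_ite, Finset.sum_const_zero, add_zero, Finset.sum_const, Finset.filter_ne',
    Finset.card_erase_of_mem (Finset.mem_univ _), Finset.card_univ, ZMod.card, nsmul_one,
    Nat.cast_pred (Fact.out : p.Prime).pos]
  simp

theorem degreeOf_lt_of_sum_eval_update_eq_zero {p n : ℕ} [Fact p.Prime]
    (R : MvPolynomial (Fin n) (ZMod p)) (hdeg : ∀ k, R.degreeOf k ≤ p - 1) (i : Fin n)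
    (hsum : ∀ x : Fin n → ZMod p,
      ∑ t : ZMod p, MvPolynomial.eval (Function.update x i t) R = 0) :
    R.degreeOf i < p - 1 := by
  have hp : 0 < p - 1 := Nat.sub_pos_of_lt (Fact.out : p.Prime).one_lt
  have hle : ∀ m ∈ R.support, ∀ k, m k ≤ p - 1 := fun m hm k =>
    (MvPolynomial.degreeOf_le_iff.1 (hdeg k)) m hm
  -- the part of `R` of degree `p - 1` in the variable `i`
  let Q : MvPolynomial (Fin n) (ZMod p) :=
    ∑ m ∈ R.support with m i = p - 1, MvPolynomial.monomial m (R.coeff m)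
  have hprod : ∀ (m : Fin n →₀ ℕ) (x : Fin n → ZMod p),
      (∏ k, x k ^ m k) = x i ^ m i * ∏ k ∈ Finset.univ.erase i, x k ^ m k := fun m x =>
    (Finset.mul_prod_erase _ _ (Finset.mem_univ i)).symm
  have heval : ∀ x, MvPolynomial.eval x Q = 0 := by
    intro x
    have hx : ∑ m ∈ R.support with m i = p - 1,
        R.coeff m * ∏ k ∈ Finset.univ.erase i, x k ^ m k = 0 := by
      have h0 := hsum x
      simp only [MvPolynomial.eval_eq'] at h0
      rw [Finset.sum_comm] at h0
      rw [Finset.sum_filter, ← neg_eq_zero, ← Finset.sum_neg_distrib]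
      refine Eq.trans ?_ h0
      refine Finset.sum_congr rfl fun m hm => ?_
      have hterm : ∀ t : ZMod p, R.coeff m * ∏ k, Function.update x i t k ^ m k =
          R.coeff m * (∏ k ∈ Finset.univ.erase i, x k ^ m k) * t ^ m i := by
        intro t
        rw [hprod, Function.update_self, Finset.prod_congr rfl fun k hk => by
          rw [Function.update_of_ne (Finset.ne_of_mem_erase hk)]]
        ring
      simp only [hterm]
      rw [← Finset.mul_sum]
      split_ifs with hmi
      · rw [hmi, ZMod.sum_pow_card_sub_one]
        ring
      · rw [FiniteField.sum_pow_lt_card_sub_one, mul_zero, neg_zero]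
        rw [ZMod.card]
        exact lt_of_le_of_ne (hle m hm i) hmi
    rw [← mul_zero (x i ^ (p - 1)), ← hx, map_sum, Finset.mul_sum]
    refine Finset.sum_congr rfl fun m hm => ?_
    rw [MvPolynomial.eval_monomial, Finsupp.prod_fintype _ _ (by simp), hprod,
      (Finset.mem_filter.1 hm).2]
    ring
  have hcoeff : ∀ m, Q.coeff m = if m ∈ R.support ∧ m i = p - 1 then R.coeff m else 0 := by
    intro m
    simp [Q, MvPolynomial.coeff_sum, MvPolynomial.coeff_monomial]
  have hQ : Q = 0 := by
    refine MvPolynomial.eq_zero_of_eval_eq_zero (Fin n) (ZMod p) Q heval ?_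
    rw [MvPolynomial.mem_restrictDegree]
    intro m hm k
    rw [ZMod.card]
    rw [MvPolynomial.mem_support_iff, hcoeff] at hm
    exact hle m (ite_ne_right_iff.1 hm).1.1 k
  rw [MvPolynomial.degreeOf_lt_iff hp]
  intro m hm
  refine lt_of_le_of_ne (hle m hm i) fun hmi => MvPolynomial.mem_support_iff.1 hm ?_
  rw [← if_pos (c := m ∈ R.support ∧ m i = p - 1) (t := R.coeff m) (e := 0) ⟨hm, hmi⟩,
    ← hcoeff, hQ, MvPolynomial.coeff_zero]

theorem stmt_18 (p : ℕ) [Fact p.Prime] (n : ℕ) (hn : 2 ≤ n)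
    (f g : (Fin n → ZMod p) → ZMod p) (i j : Fin n) (hij : i ≠ j)
    (h : ∀ x : Fin n → ZMod p,
      delta (Pi.single i (1 : ZMod p)) f x = delta (Pi.single j (1 : ZMod p)) g x)
    (R : MvPolynomial (Fin n) (ZMod p))
    (hdeg : ∀ k : Fin n, R.degreeOf k ≤ p - 1)
    (hval : ∀ x : Fin n → ZMod p,
      delta (Pi.single i (1 : ZMod p)) f x = MvPolynomial.eval x R) :
    R.degreeOf i < p - 1 ∧ R.degreeOf j < p - 1 := by
  constructor
  · refine degreeOf_lt_of_sum_eval_update_eq_zero R hdeg i fun x => ?_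
    simp only [← hval, sum_delta_update_eq_zero]
  · refine degreeOf_lt_of_sum_eval_update_eq_zero R hdeg j fun x => ?_
    simp only [← hval, h, sum_delta_update_eq_zero]
end

section
/- Let p be a prime, n ≥ 2, and f, g : (Fin n → ZMod p) → ZMod p functions with algebraic normal forms P and Q respectively (polynomials over ZMod p with degree at most p−1 in each variable, evaluating to f and g). Write f_{(i_1,…,i_n)} and g_{(i_1,…,i_n)} for the coefficients of P and Q on the monomial x_1^{i_1}⋯x_n^{i_n}, and let e_1, e_2 be the first two standard basis vectors. Then Δ_{e_1} f(x) = Δ_{e_2} g(x) for all x if and only if both of the following hold: (1) for all integers i_1, i_2 with 0 ≤ i_1, i_2 ≤ p−2 and all exponent tuples (i_3,…,i_n) with each entry ≤ p−1, one has Σ_{k=i_1+1}^{p−1} C(k, k−i_1) · f_{(k, i_2, i_3,…,i_n)} = Σ_{k=i_2+1}^{p−1} C(k, k−i_2) · g_{(i_1, k, i_3,…,i_n)} in ZMod p; and (2) for all integers j with 0 ≤ j ≤ p−2 and all such tuples (i_3,…,i_n), one has Σ_{k=j+1}^{p−1} C(k, k−j) · f_{(k, p−1, i_3,…,i_n)}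 = 0 and Σ_{k=j+1}^{p−1} C(k, k−j) · g_{(p−1, k, i_3,…,i_n)} = 0 in ZMod p. Here C(a,b) denotes the binomial coefficient, cast into ZMod p. -/
open MvPolynomial in
/-- The polynomial obtained by substituting `X i + 1` for `X i`. -/
noncomputable def shiftPoly {σ R : Type*} [DecidableEq σ] [CommRing R] (i : σ)
    (P : MvPolynomial σ R) : MvPolynomial σ R :=
  bind₁ (fun j => X j + C ((Pi.single i 1 : σ → R) j)) P

section ShiftPoly

open MvPolynomial

variable {σ R : Type*} [DecidableEq σ] [CommRing R]

lemma eval_shiftPoly (i : σ) (P : MvPolynomial σ R) (x : σ → R) :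
    eval x (shiftPoly i P) = eval (x + Pi.single i 1) P := by
  rw [shiftPoly, ← aeval_eq_eval, ← aeval_eq_eval]
  change aeval x (bind₁ _ P) = aeval _ P
  rw [aeval_bind₁]
  congr 2
  funext j
  simp [Pi.add_apply]

lemma shiftPoly_monomial (i : σ) (s : σ →₀ ℕ) (c : R) :
    shiftPoly i (monomial s c) =
      ∑ l ∈ Finset.range (s i + 1), monomial (s.erase i + Finsupp.single i l)
        (c * ((s i).choose l : R)) := by
  have hs : monomial s c = monomial (s.erase i) c * X i ^ s i := by
    rw [X_pow_eq_monomial, monomial_mul, mul_one, Finsupp.erase_add_single]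
  have h1 : shiftPoly i (monomial (s.erase i) c) = monomial (s.erase i) c := by
    rw [shiftPoly, bind₁_monomial, monomial_eq]
    congr 1
    refine Finset.prod_congr rfl fun j hj => ?_
    have hji : j ≠ i := by
      rintro rfl
      simp at hj
    simp [hji]
  have h2 : shiftPoly i (monomial s c) = shiftPoly i (monomial (s.erase i) c)
      * (X i + 1) ^ s i := by
    rw [hs]
    simp [shiftPoly]
  rw [h2, h1, add_pow, Finset.mul_sum]
  refine Finset.sum_congr rfl fun l _ => ?_
  rw [one_pow, mul_one, X_pow_eq_monomial, ← mul_assoc, monomial_mul, mul_one,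
    ← map_natCast (C : R →+* MvPolynomial σ R), mul_comm, C_mul_monomial, mul_comm]

lemma coeff_shiftPoly_monomial (i : σ) (s m : σ →₀ ℕ) (c : R) :
    coeff m (shiftPoly i (monomial s c)) =
      if s = m.update i (s i) then ((s i).choose (m i) : R) * c else 0 := by
  rw [shiftPoly_monomial, coeff_sum]
  simp only [coeff_monomial]
  split_ifs with h
  · rw [Finset.sum_eq_single (m i)]
    · have : s.erase i + Finsupp.single i (m i) = m := by
        ext j
        have hj := DFunLike.congr_fun h j
        by_cases hji : j = i
        · subst hji
          simp
        · simpa [Finsupp.update_apply, Finsupp.erase_ne, hji, Ne.symm hji] using hj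
      rw [if_pos this, mul_comm]
    · intro l _ hl
      refine if_neg fun h' => hl ?_
      have := DFunLike.congr_fun h' i
      simpa using this
    · intro hm
      rw [Finset.mem_range, not_lt] at hm
      rw [Nat.choose_eq_zero_of_lt (by omega)]
      simp
  · refine Finset.sum_eq_zero fun l _ => if_neg fun h' => h ?_
    ext j
    have hj := DFunLike.congr_fun h' j
    by_cases hji : j = i
    · subst hji
      simp
    · simpa [Finsupp.update_apply, Finsupp.erase_ne, hji, Ne.symm hji] using hj

lemma coeff_shiftPoly {i : σ} {P : MvPolynomial σ R} {N : ℕ} (hP : P.degreeOf i ≤ N)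
    (m : σ →₀ ℕ) :
    coeff m (shiftPoly i P) =
      ∑ k ∈ Finset.range (N + 1), (k.choose (m i) : R) * coeff (m.update i k) P := by
  have hsum : shiftPoly i P = ∑ s ∈ P.support, shiftPoly i (monomial s (coeff s P)) := by
    conv_lhs => rw [P.as_sum]
    simp only [shiftPoly, map_sum]
  have hcoeff (t : σ →₀ ℕ) : coeff t P = ∑ s ∈ P.support, if s = t then coeff s P else 0 := by
    rw [Finset.sum_ite_eq']
    split_ifs with h
    · rfl
    · simpa using h
  rw [hsum, coeff_sum]
  simp only [hcoeff (m.update i _), Finset.mul_sum]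
  rw [Finset.sum_comm]
  refine Finset.sum_congr rfl fun s hs => ?_
  rw [coeff_shiftPoly_monomial, Finset.sum_eq_single (s i)]
  · simp
  · intro k _ hk
    rw [if_neg, mul_zero]
    intro h
    exact hk (by rw [h]; simp)
  · intro h
    exact absurd (Finset.mem_range.2 (Nat.lt_succ_of_le ((monomial_le_degreeOf i hs).trans hP))) h

lemma coeff_shiftPoly_sub {i : σ} {P : MvPolynomial σ R} {N : ℕ} (hP : P.degreeOf i ≤ N)
    {m : σ →₀ ℕ} (hm : m i ≤ N) :
    coeff m (shiftPoly i P - P) =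
      ∑ k ∈ Finset.Icc (m i + 1) N, (k.choose (k - m i) : R) * coeff (m.update i k) P := by
  have hsub : Finset.Icc (m i) N ⊆ Finset.range (N + 1) := by
    intro k
    simp only [Finset.mem_Icc, Finset.mem_range]
    omega
  rw [coeff_sub, coeff_shiftPoly hP, ← Finset.sum_subset hsub, ← Finset.add_sum_Ioc_eq_sum_Icc hm,
    Nat.choose_self, Finsupp.update_self, Nat.cast_one, one_mul, add_sub_cancel_left]
  · refine Finset.sum_congr (by ext; simp) fun k hk => ?_
    rw [Nat.choose_symm (Nat.le_of_succ_le (Finset.mem_Icc.1 hk).1)]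
  · intro k hk hk'
    simp only [Finset.mem_Icc, Finset.mem_range] at hk hk'
    rw [Nat.choose_eq_zero_of_lt (by omega)]
    simp

lemma shiftPoly_sub_mem_restrictDegree {i : σ} {P : MvPolynomial σ R} {N : ℕ}
    (hP : ∀ j, P.degreeOf j ≤ N) : shiftPoly i P - P ∈ restrictDegree σ R N := by
  have hcoeff {t : σ →₀ ℕ} {j : σ} (ht : N < t j) : coeff t P = 0 := by
    by_contra h
    have := (monomial_le_degreeOf j (mem_support_iff.2 h)).trans (hP j)
    omega
  rw [mem_restrictDegree]
  intro s hs j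
  by_contra! hj
  refine mem_support_iff.1 hs ?_
  rw [coeff_sub, coeff_shiftPoly (hP i), hcoeff hj, sub_zero]
  refine Finset.sum_eq_zero fun k hk => ?_
  by_cases hji : j = i
  · subst hji
    rw [Nat.choose_eq_zero_of_lt (by rw [Finset.mem_range] at hk; omega)]
    simp
  · rw [hcoeff (j := j), mul_zero]
    simpa [Finsupp.update_apply, hji] using hj

lemma coeff_shiftPoly_sub_of_eq {i : σ} {P : MvPolynomial σ R} {N : ℕ}
    (hP : P.degreeOf i ≤ N) {m : σ →₀ ℕ} (hm : m i = N) :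
    coeff m (shiftPoly i P - P) = 0 := by
  rw [coeff_shiftPoly_sub hP hm.le, hm, Finset.Icc_eq_empty (by omega), Finset.sum_empty]

end ShiftPoly

open MvPolynomial in
lemma delta_eq_delta_iff_coeff {σ : Type} [Finite σ] [DecidableEq σ] {p : ℕ} [Fact p.Prime]
    {f g : (σ → ZMod p) → ZMod p} {P Q : MvPolynomial σ (ZMod p)} (a b : σ)
    (hPdeg : ∀ j, P.degreeOf j ≤ p - 1) (hPval : ∀ x, f x = eval x P)
    (hQdeg : ∀ j, Q.degreeOf j ≤ p - 1) (hQval : ∀ x, g x = eval x Q) :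
    (∀ x, delta (Pi.single a (1 : ZMod p)) f x = delta (Pi.single b (1 : ZMod p)) g x) ↔
      ∀ m : σ →₀ ℕ, (∀ j, m j ≤ p - 1) →
        coeff m (shiftPoly a P - P) = coeff m (shiftPoly b Q - Q) := by
  have hdelta (x : σ → ZMod p) :
      delta (Pi.single a (1 : ZMod p)) f x = delta (Pi.single b (1 : ZMod p)) g x ↔
        eval x (shiftPoly a P - P) = eval x (shiftPoly b Q - Q) := by
    simp [delta, hPval, hQval, eval_shiftPoly]
  have hP := shiftPoly_sub_mem_restrictDegree (i := a) hPdeg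
  have hQ := shiftPoly_sub_mem_restrictDegree (i := b) hQdeg
  simp only [hdelta]
  constructor
  · intro h m _
    have := eq_zero_of_eval_eq_zero σ (ZMod p) (shiftPoly a P - P - (shiftPoly b Q - Q))
      (fun x => by rw [map_sub, h x, sub_self]) (by
        rw [ZMod.card]
        exact Submodule.sub_mem _ hP hQ)
    rw [sub_eq_zero.1 this]
  · intro h x
    congr 1
    ext m
    by_cases hm : ∀ j, m j ≤ p - 1
    · exact h m hm
    · rw [notMem_support_iff.1 fun hs => hm ((mem_restrictDegree _ _ _).1 hP m hs),
        notMem_support_iff.1 fun hs => hm ((mem_restrictDegree _ _ _).1 hQ m hs)]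

lemma Finsupp.exists_eq_add_single_add_single {σ : Type*} {a b : σ} (hab : a ≠ b) (m : σ →₀ ℕ) :
    ∃ w : σ →₀ ℕ, w a = 0 ∧ w b = 0 ∧ (∀ j, w j ≤ m j) ∧
      m = w + Finsupp.single a (m a) + Finsupp.single b (m b) := by
  classical
  refine ⟨(m.erase b).erase a, ?_, ?_, fun j => ?_, ?_⟩
  · simp
  · simp [Finsupp.erase_apply]
  · simp only [Finsupp.erase_apply]
    split_ifs <;> simp
  · have : m a = m.erase b a := (Finsupp.erase_ne hab).symm
    rw [this, Finsupp.erase_add_single, Finsupp.erase_add_single]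

theorem stmt_19 (p : ℕ) [Fact p.Prime] (n : ℕ) (hn : 2 ≤ n)
    (f g : (Fin n → ZMod p) → ZMod p)
    (P Q : MvPolynomial (Fin n) (ZMod p))
    (hPdeg : ∀ j : Fin n, P.degreeOf j ≤ p - 1)
    (hPval : ∀ x : Fin n → ZMod p, f x = MvPolynomial.eval x P)
    (hQdeg : ∀ j : Fin n, Q.degreeOf j ≤ p - 1)
    (hQval : ∀ x : Fin n → ZMod p, g x = MvPolynomial.eval x Q) :
    (∀ x : Fin n → ZMod p,
        delta (Pi.single (⟨0, by omega⟩ : Fin n) (1 : ZMod p)) f x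
          = delta (Pi.single (⟨1, by omega⟩ : Fin n) (1 : ZMod p)) g x)
      ↔ ((∀ i₁ i₂ : ℕ, i₁ ≤ p - 2 → i₂ ≤ p - 2 →
            ∀ w : Fin n →₀ ℕ, w ⟨0, by omega⟩ = 0 → w ⟨1, by omega⟩ = 0 →
              (∀ j : Fin n, w j ≤ p - 1) →
            ∑ k ∈ Finset.Icc (i₁ + 1) (p - 1),
                (k.choose (k - i₁) : ZMod p) *
                  P.coeff (w + Finsupp.single (⟨0, by omega⟩ : Fin n) k
                    + Finsupp.single (⟨1, by omega⟩ : Fin n) i₂)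
              = ∑ k ∈ Finset.Icc (i₂ + 1) (p - 1),
                (k.choose (k - i₂) : ZMod p) *
                  Q.coeff (w + Finsupp.single (⟨0, by omega⟩ : Fin n) i₁
                    + Finsupp.single (⟨1, by omega⟩ : Fin n) k))
        ∧ (∀ j : ℕ, j ≤ p - 2 →
            ∀ w : Fin n →₀ ℕ, w ⟨0, by omega⟩ = 0 → w ⟨1, by omega⟩ = 0 →
              (∀ j' : Fin n, w j' ≤ p - 1) →
            (∑ k ∈ Finset.Icc (j + 1) (p - 1),
                (k.choose (k - j) : ZMod p) *
                  P.coeff (w + Finsupp.single (⟨0, by omega⟩ : Fin n) k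
                    + Finsupp.single (⟨1, by omega⟩ : Fin n) (p - 1)) = 0)
            ∧ (∑ k ∈ Finset.Icc (j + 1) (p - 1),
                (k.choose (k - j) : ZMod p) *
                  Q.coeff (w + Finsupp.single (⟨0, by omega⟩ : Fin n) (p - 1)
                    + Finsupp.single (⟨1, by omega⟩ : Fin n) k) = 0))) := by
  rw [delta_eq_delta_iff_coeff _ _ hPdeg hPval hQdeg hQval]
  have hp : 2 ≤ p := (Fact.out : p.Prime).two_le
  generalize ha : (⟨0, by omega⟩ : Fin n) = a
  generalize hb : (⟨1, by omega⟩ : Fin n) = b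
  have hab : a ≠ b := by
    rw [← ha, ← hb]
    simp
  have key (w : Fin n →₀ ℕ) (hwa : w a = 0) (hwb : w b = 0) (i k : ℕ) :
      (w + Finsupp.single a i + Finsupp.single b k) a = i ∧
      (w + Finsupp.single a i + Finsupp.single b k) b = k ∧
      (∀ l, (w + Finsupp.single a i + Finsupp.single b k).update a l =
        w + Finsupp.single a l + Finsupp.single b k) ∧
      (∀ l, (w + Finsupp.single a i + Finsupp.single b k).update b l =
        w + Finsupp.single a i + Finsupp.single b l) := by
    refine ⟨by simp [hwa, hab], by simp [hwb, hab], fun l => ?_, fun l => ?_⟩ <;>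
    · ext j
      by_cases hja : j = a
      · subst hja
        simp [Finsupp.update_apply, hwa, hab]
      · by_cases hjb : j = b
        · subst hjb
          simp [Finsupp.update_apply, hwb, hab.symm]
        · simp [Finsupp.update_apply, hja, hjb]
  have hle (w : Fin n →₀ ℕ) (hwa : w a = 0) (hwb : w b = 0) (hw : ∀ j, w j ≤ p - 1) (i k : ℕ)
      (hi : i ≤ p - 1) (hk : k ≤ p - 1) (j : Fin n) :
      (w + Finsupp.single a i + Finsupp.single b k) j ≤ p - 1 := by
    by_cases hja : j = a
    · rw [hja, (key w hwa hwb i k).1]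
      exact hi
    · by_cases hjb : j = b
      · rw [hjb, (key w hwa hwb i k).2.1]
        exact hk
      · simpa [Finsupp.single_apply, Ne.symm hja, Ne.symm hjb] using hw j
  have hcP (w : Fin n →₀ ℕ) (hwa : w a = 0) (hwb : w b = 0) (i k : ℕ) (hi : i ≤ p - 1) :
      MvPolynomial.coeff (w + Finsupp.single a i + Finsupp.single b k) (shiftPoly a P - P) =
        ∑ l ∈ Finset.Icc (i + 1) (p - 1), (l.choose (l - i) : ZMod p) *
          P.coeff (w + Finsupp.single a l + Finsupp.single b k) := by
    obtain ⟨h1, -, h3, -⟩ := key w hwa hwb i k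
    rw [coeff_shiftPoly_sub (hPdeg a) (h1.trans_le hi), h1]
    simp only [h3]
  have hcQ (w : Fin n →₀ ℕ) (hwa : w a = 0) (hwb : w b = 0) (i k : ℕ) (hk : k ≤ p - 1) :
      MvPolynomial.coeff (w + Finsupp.single a i + Finsupp.single b k) (shiftPoly b Q - Q) =
        ∑ l ∈ Finset.Icc (k + 1) (p - 1), (l.choose (l - k) : ZMod p) *
          Q.coeff (w + Finsupp.single a i + Finsupp.single b l) := by
    obtain ⟨-, h2, -, h4⟩ := key w hwa hwb i k
    rw [coeff_shiftPoly_sub (hQdeg b) (h2.trans_le hk), h2]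
    simp only [h4]
  constructor
  · intro h
    refine ⟨fun i₁ i₂ h₁ h₂ w hwa hwb hw => ?_, fun j hj w hwa hwb hw => ⟨?_, ?_⟩⟩
    · rw [← hcP w hwa hwb _ _ (by omega), ← hcQ w hwa hwb _ _ (by omega)]
      exact h _ (hle w hwa hwb hw _ _ (by omega) (by omega))
    · rw [← hcP w hwa hwb _ _ (by omega), h _ (hle w hwa hwb hw _ _ (by omega) le_rfl)]
      exact coeff_shiftPoly_sub_of_eq (hQdeg b) (key w hwa hwb _ _).2.1
    · rw [← hcQ w hwa hwb _ _ (by omega), ← h _ (hle w hwa hwb hw _ _ le_rfl (by omega))]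
      exact coeff_shiftPoly_sub_of_eq (hPdeg a) (key w hwa hwb _ _).1
  · rintro ⟨h₁, h₂⟩ m hm
    by_cases hma : m a = p - 1 <;> by_cases hmb : m b = p - 1
    · rw [coeff_shiftPoly_sub_of_eq (hPdeg a) hma, coeff_shiftPoly_sub_of_eq (hQdeg b) hmb]
    all_goals
      have hma' := hm a
      have hmb' := hm b
      obtain ⟨w, hwa, hwb, hwm, hmw⟩ := Finsupp.exists_eq_add_single_add_single hab m
      have hw (j) : w j ≤ p - 1 := (hwm j).trans (hm j)
    · rw [coeff_shiftPoly_sub_of_eq (hPdeg a) hma, hmw, hcQ w hwa hwb _ _ hmb', hma]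
      exact (h₂ (m b) (by omega) w hwa hwb hw).2.symm
    · rw [coeff_shiftPoly_sub_of_eq (hQdeg b) hmb, hmw, hcP w hwa hwb _ _ hma', hmb]
      exact (h₂ (m a) (by omega) w hwa hwb hw).1
    · rw [hmw, hcP w hwa hwb _ _ hma', hcQ w hwa hwb _ _ hmb']
      exact h₁ _ _ (by omega) (by omega) w hwa hwb hw
end
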